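/- Let K be a field of characteristic p where p = 7ℓ+2 is prime with ℓ ≥ 1, and let R = K[x,y,z]/(x^7+y^7-z^7). Then x^{3p²} y^{3p²} does not belong to the ideal (x^{4p²}, y^{4p²}, z^{4p²}) of R. -/

import Mathlib

open MvPolynomial in
/-- The ideal (x^7 + y^7 - z^7) in K[x,y,z]. -/
noncomputable def fermatIdeal (K : Type*) [Field K] : Ideal (MvPolynomial (Fin 3) K) :=
  Ideal.span {(X 0 : MvPolynomial (Fin 3) K) ^ 7 + X 1 ^ 7 - X 2 ^ 7}

/-- The Fermat ring K[x,y,z]/(x^7+y^7-z^7). -/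
noncomputable def FermatRing (K : Type*) [Field K] : Type _ :=
  MvPolynomial (Fin 3) K ⧸ fermatIdeal K

noncomputable instance (K : Type*) [Field K] : CommRing (FermatRing K) :=
  Ideal.Quotient.commRing (fermatIdeal K)

open MvPolynomial in
/-- The class of x in the Fermat ring. -/
noncomputable def fx (K : Type*) [Field K] : FermatRing K := Ideal.Quotient.mk _ (X 0)

open MvPolynomial in
/-- The class of y in the Fermat ring. -/
noncomputable def fy (K : Type*) [Field K] : FermatRing K := Ideal.Quotient.mk _ (X 1)

open MvPolynomial in
/-- The class of z in the Fermat ring. -/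
noncomputable def fz (K : Type*) [Field K] : FermatRing K := Ideal.Quotient.mk _ (X 2)

open Finset in
/-- The alternating binomial sum of a polynomial of degree less than `n` vanishes. -/
theorem sum_neg_one_pow_mul_choose_mul_eval_eq_zero {P : Polynomial ℤ} {n : ℕ}
    (hP : P.natDegree < n) :
    ∑ j ∈ range (n + 1), (-1) ^ j * (n.choose j : ℤ) * P.eval (j : ℤ) = 0 := by
  have h := congrFun (Polynomial.fwdDiff_iter_eq_zero_of_degree_lt hP) 0
  rw [fwdDiff_iter_eq_sum_shift] at h
  have h' := congrArg (fun t : ℤ => (-1) ^ n * t) h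
  simp only [mul_sum, Pi.zero_apply, mul_zero] at h'
  rw [← h']
  refine sum_congr rfl fun j hj => ?_
  obtain ⟨e, rfl⟩ := Nat.exists_eq_add_of_le (Nat.lt_succ_iff.mp (mem_range.mp hj))
  have he : ((-1 : ℤ) ^ e) * (-1) ^ e = 1 := by rw [← mul_pow]; simp
  simp only [add_tsub_cancel_left, zero_add, nsmul_eq_mul, mul_one, smul_eq_mul, pow_add]
  linear_combination (-((-1) ^ j * ((j + e).choose j : ℤ) * P.eval (j : ℤ))) * he

/-- Clearing denominators in a product of three binomial coefficients. -/
theorem choose_mul_choose_mul_choose_eq {n i j : ℕ} (hj : j ≤ n) (hi : n < i) (hi' : i ≤ 2 * n) :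
    n.factorial ^ 3 * ((2 * n - j).choose n * (n + j).choose n * (2 * n + 1).choose (i - j)) =
      (2 * n + 1).factorial * (n.choose j * ((2 * n - j).descFactorial (2 * n - i) *
        (n + j).descFactorial (i - n - 1))) := by
  have h₁ := Nat.choose_mul_factorial_mul_factorial (show n ≤ 2 * n - j by omega)
  have h₂ := Nat.choose_mul_factorial_mul_factorial (show n ≤ n + j by omega)
  have h₃ := Nat.choose_mul_factorial_mul_factorial (show i - j ≤ 2 * n + 1 by omega)
  have h₄ := Nat.choose_mul_factorial_mul_factorial hj
  have h₅ := Nat.factorial_mul_descFactorial (show 2 * n - i ≤ 2 * n - j by omega)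
  have h₆ := Nat.factorial_mul_descFactorial (show i - n - 1 ≤ n + j by omega)
  rw [show 2 * n - j - n = n - j by omega] at h₁
  rw [show n + j - n = j by omega] at h₂
  rw [show 2 * n - j - (2 * n - i) = i - j by omega] at h₅
  rw [show n + j - (i - n - 1) = 2 * n + 1 - (i - j) by omega] at h₆
  have hpos : 0 < j.factorial * (n - j).factorial * (i - j).factorial *
      (2 * n + 1 - (i - j)).factorial := by positivity
  refine Nat.eq_of_mul_eq_mul_right hpos ?_
  calc _ = n.factorial * ((2 * n - j).choose n * n.factorial * (n - j).factorial) *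
        ((n + j).choose n * n.factorial * j.factorial) *
        ((2 * n + 1).choose (i - j) * (i - j).factorial *
          (2 * n + 1 - (i - j)).factorial) := by ring
    _ = (n.choose j * j.factorial * (n - j).factorial) *
        ((i - j).factorial * (2 * n - j).descFactorial (2 * n - i)) *
        ((2 * n + 1 - (i - j)).factorial * (n + j).descFactorial (i - n - 1)) *
        (2 * n + 1).factorial := by rw [h₁, h₂, h₃, h₄, h₅, h₆]
    _ = _ := by ring

open Finset Polynomial in
/-- The middle coefficients of the product of `(1 + t) ^ (2 * n + 1)` with its Padé denominator
of degree `n` vanish. -/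
theorem sum_neg_one_pow_mul_choose_mul_choose_mul_choose {n i : ℕ} (hi : n < i)
    (hi' : i ≤ 2 * n) :
    ∑ j ∈ range (n + 1), (-1) ^ j * ((2 * n - j).choose n * (n + j).choose n : ℤ) *
      ((2 * n + 1).choose (i - j) : ℤ) = 0 := by
  let P : ℤ[X] := (descPochhammer ℤ (2 * n - i)).comp (C (2 * n : ℤ) - X) *
    (descPochhammer ℤ (i - n - 1)).comp (X + C (n : ℤ))
  have hdeg : P.natDegree < n := by
    have h₁ : (C (2 * n : ℤ) - X).natDegree = 1 := by
      rw [← neg_sub, natDegree_neg, natDegree_X_sub_C]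
    refine natDegree_mul_le.trans_lt ?_
    rw [natDegree_comp, natDegree_comp, natDegree_X_add_C, h₁, descPochhammer_natDegree,
      descPochhammer_natDegree]
    omega
  have hP := sum_neg_one_pow_mul_choose_mul_eval_eq_zero hdeg
  have hn : (n.factorial : ℤ) ^ 3 ≠ 0 := by positivity
  refine (mul_eq_zero.mp ?_).resolve_left hn
  rw [mul_sum]
  refine Eq.trans ?_ (mul_eq_zero_of_right ((2 * n + 1).factorial : ℤ) hP)
  rw [mul_sum]
  refine sum_congr rfl fun j hj => ?_
  have hjn := Nat.lt_succ_iff.mp (mem_range.mp hj)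
  have heval : P.eval (j : ℤ) = (((2 * n - j).descFactorial (2 * n - i) *
      (n + j).descFactorial (i - n - 1) : ℕ) : ℤ) := by
    have hsub : (2 * n - j : ℤ) = ((2 * n - j : ℕ) : ℤ) := by
      push_cast [show j ≤ 2 * n by omega]; ring
    have hadd : (j + n : ℤ) = ((n + j : ℕ) : ℤ) := by push_cast; ring
    simp only [P, eval_mul, eval_comp, eval_sub, eval_add, eval_C, eval_X]
    rw [hsub, hadd, descPochhammer_eval_eq_descFactorial, descPochhammer_eval_eq_descFactorial,
      Nat.cast_mul]
  have h := congrArg (Nat.cast : ℕ → ℤ) (choose_mul_choose_mul_choose_eq hjn hi hi')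
  rw [heval]
  push_cast at h ⊢
  linear_combination (-1) ^ j * h

open Finset in
theorem pow_mul_pow_mul_add_pow_sub_mem {T : Type*} [CommRing T] (X Y : T) {n j : ℕ}
    (hj : j ≤ n) :
    X ^ j * Y ^ (n - j) * (X + Y) ^ (2 * n + 1) -
      ∑ i ∈ Ioc n (2 * n), ((2 * n + 1).choose (i - j) : T) * (X ^ i * Y ^ (3 * n + 1 - i)) ∈
        Ideal.span {X ^ (2 * n + 1), Y ^ (2 * n + 1)} := by
  have hexp : X ^ j * Y ^ (n - j) * (X + Y) ^ (2 * n + 1) =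
      ∑ i ∈ Ico j (j + (2 * n + 2)),
        ((2 * n + 1).choose (i - j) : T) * (X ^ i * Y ^ (3 * n + 1 - i)) := by
    rw [add_pow, sum_Ico_eq_sum_range, mul_sum, add_tsub_cancel_left]
    refine sum_congr rfl fun m hm => ?_
    have hm' := mem_range.mp hm
    rw [add_tsub_cancel_left, show 3 * n + 1 - (j + m) = (n - j) + (2 * n + 1 - m) by omega]
    ring
  have hsub : Ioc n (2 * n) ⊆ Ico j (j + (2 * n + 2)) := fun i hi => by
    simp only [mem_Ioc, mem_Ico] at hi ⊢
    omega
  rw [hexp, ← sum_sdiff hsub, add_sub_cancel_right]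
  refine Ideal.sum_mem _ fun i hi => Ideal.mul_mem_left _ _ ?_
  simp only [mem_sdiff, mem_Ioc, mem_Ico, not_and, not_le] at hi
  rcases le_or_gt i n with hin | hin
  · refine Ideal.mul_mem_left _ _ (Ideal.mem_of_dvd _ (pow_dvd_pow _ ?_)
      (Ideal.subset_span (Set.mem_insert_of_mem _ rfl)))
    omega
  · refine Ideal.mul_mem_right _ _ (Ideal.mem_of_dvd _ (pow_dvd_pow _ ?_)
      (Ideal.subset_span (Set.mem_insert _ _)))
    exact hi.2 hin

/-- The coefficients of the Padé denominator of degree `n` of `(1 + t) ^ (2 * n + 1)`. -/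
def padeCoeff (n j : ℕ) : ℤ := (-1) ^ j * ((2 * n - j).choose n * (n + j).choose n : ℕ)

open Finset in
/-- The homogenized Padé denominator of `(1 + t) ^ (2 * n + 1)` multiplies `(X + Y) ^ (2 * n + 1)`
into the ideal `(X ^ (2 * n + 1), Y ^ (2 * n + 1))`. -/
theorem sum_padeCoeff_mul_add_pow_mem {T : Type*} [CommRing T] (X Y : T) (n : ℕ) :
    (∑ j ∈ range (n + 1), (padeCoeff n j : T) * (X ^ j * Y ^ (n - j))) * (X + Y) ^ (2 * n + 1) ∈
      Ideal.span {X ^ (2 * n + 1), Y ^ (2 * n + 1)} := by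
  have hmem := Ideal.sum_mem _ fun j (hj : j ∈ range (n + 1)) => Ideal.mul_mem_left _
    (padeCoeff n j : T)
    (pow_mul_pow_mul_add_pow_sub_mem X Y (Nat.lt_succ_iff.mp (mem_range.mp hj)))
  have hzero : ∑ j ∈ range (n + 1), (padeCoeff n j : T) * ∑ i ∈ Ioc n (2 * n),
      ((2 * n + 1).choose (i - j) : T) * (X ^ i * Y ^ (3 * n + 1 - i)) = 0 := by
    simp only [mul_sum]
    rw [sum_comm]
    refine sum_eq_zero fun i hi => ?_
    have hi' := mem_Ioc.mp hi
    have h := congrArg (Int.cast : ℤ → T)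
      (sum_neg_one_pow_mul_choose_mul_choose_mul_choose hi'.1 hi'.2)
    simp only [← mul_assoc]
    rw [← sum_mul, ← sum_mul]
    refine mul_eq_zero_of_left (mul_eq_zero_of_left ?_ _) _
    rw [Int.cast_sum, Int.cast_zero] at h
    rw [← h]
    refine sum_congr rfl fun j _ => ?_
    simp [padeCoeff]
  simp only [mul_sub, sum_sub_distrib, hzero, sub_zero] at hmem
  simpa only [sum_mul, mul_assoc] using hmem

open Finset in
/-- Frobenius twist of `sum_padeCoeff_mul_add_pow_mem`, with exponents raised by `m`. -/
theorem sum_padeCoeff_pow_mul_add_pow_mem {T : Type*} [CommRing T] (p : ℕ) [ExpChar T p]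
    (X Y : T) (n m : ℕ) :
    (∑ j ∈ range (n + 1), (padeCoeff n j : T) ^ p * (X ^ (p * j) * Y ^ (p * (n - j)))) *
        (X ^ m * Y ^ m) * (X + Y) ^ (p * (2 * n + 1) + m) ∈
      Ideal.span {X ^ (p * (2 * n + 1) + m), Y ^ (p * (2 * n + 1) + m)} := by
  obtain ⟨A, B, h⟩ := Ideal.mem_span_pair.mp (sum_padeCoeff_mul_add_pow_mem X Y n)
  refine Ideal.mem_span_pair.mpr
    ⟨A ^ p * Y ^ m * (X + Y) ^ m, B ^ p * X ^ m * (X + Y) ^ m, ?_⟩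
  have h' := congrArg (· ^ p) h
  simp only [mul_pow, add_pow_expChar, sum_pow_char, ← pow_mul'] at h'
  simp only [pow_add]
  linear_combination (X ^ m * Y ^ m * (X + Y) ^ m) * h'

theorem Polynomial.Monic.adjoinRoot_of_injective {S : Type*} [CommRing S] {f : Polynomial S} (hf : f.Monic)
    (hdeg : 0 < f.natDegree) : Function.Injective (AdjoinRoot.of f) := by
  refine (injective_iff_map_eq_zero _).mpr fun a ha => by_contra fun hne => ?_
  rw [← AdjoinRoot.mk_C, AdjoinRoot.mk_eq_zero] at ha
  exact hf.not_dvd_of_natDegree_lt (Polynomial.C_ne_zero.mpr hne)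
    (by rwa [Polynomial.natDegree_C]) ha

theorem fz_pow_seven (K : Type*) [Field K] : fz K ^ 7 = fx K ^ 7 + fy K ^ 7 := by
  have h : (MvPolynomial.X 0 : MvPolynomial (Fin 3) K) ^ 7 + MvPolynomial.X 1 ^ 7 -
      MvPolynomial.X 2 ^ 7 ∈ fermatIdeal K := Ideal.subset_span rfl
  have h' := Ideal.Quotient.eq_zero_iff_mem.mpr h
  rw [map_sub, map_add, map_pow, map_pow, map_pow] at h'
  exact (sub_eq_zero.mp h').symm

/-- The quotient map onto the Fermat ring. -/
noncomputable def fermatMk (K : Type*) [Field K] : MvPolynomial (Fin 3) K →+* FermatRing K :=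
  Ideal.Quotient.mk (fermatIdeal K)

/-- The inclusion of `K[x, y]` into the Fermat ring. -/
noncomputable def fermatInclusion (K : Type*) [Field K] :
    MvPolynomial (Fin 2) K →+* FermatRing K :=
  (fermatMk K).comp (MvPolynomial.rename Fin.castSucc).toRingHom

@[simp]
theorem fermatInclusion_X_zero (K : Type*) [Field K] :
    fermatInclusion K (MvPolynomial.X 0) = fx K :=
  congrArg (fermatMk K) (MvPolynomial.rename_X _ _)

@[simp]
theorem fermatInclusion_X_one (K : Type*) [Field K] :
    fermatInclusion K (MvPolynomial.X 1) = fy K :=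
  congrArg (fermatMk K) (MvPolynomial.rename_X _ _)

/-- Ideals of `K[x, y]` are contracted from the Fermat ring. -/
theorem mem_of_fermatInclusion_mem_map {K : Type*} [Field K]
    {J : Ideal (MvPolynomial (Fin 2) K)} {f : MvPolynomial (Fin 2) K}
    (hf : fermatInclusion K f ∈ J.map (fermatInclusion K)) : f ∈ J := by
  by_cases hJ : J = ⊤
  · exact hJ ▸ Submodule.mem_top
  have := Ideal.Quotient.nontrivial_iff.mpr hJ
  let s := Ideal.Quotient.mk J (MvPolynomial.X 0 ^ 7 + MvPolynomial.X 1 ^ 7)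
  let g := Polynomial.X ^ 7 - Polynomial.C s
  let ι := (AdjoinRoot.of g).comp (Ideal.Quotient.mk J)
  let ψ : MvPolynomial (Fin 3) K →+* AdjoinRoot g :=
    MvPolynomial.eval₂Hom (ι.comp MvPolynomial.C)
      ![ι (MvPolynomial.X 0), ι (MvPolynomial.X 1), AdjoinRoot.root g]
  have hroot : AdjoinRoot.root g ^ 7 = AdjoinRoot.of g s := by
    have h := AdjoinRoot.eval₂_root g
    simp only [g, Polynomial.eval₂_sub, Polynomial.eval₂_pow, Polynomial.eval₂_X,
      Polynomial.eval₂_C] at h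
    exact sub_eq_zero.mp h
  have hψ : ∀ a ∈ fermatIdeal K, ψ a = 0 := fun a ha => by
    refine (Ideal.span_le (I := RingHom.ker ψ)).mpr ?_ ha
    rw [Set.singleton_subset_iff, SetLike.mem_coe, RingHom.mem_ker]
    simp [ψ, hroot, ι, s]
  let φ : FermatRing K →+* AdjoinRoot g := Ideal.Quotient.lift (fermatIdeal K) ψ hψ
  have hφ : φ.comp (fermatInclusion K) = ι := by
    change ψ.comp (MvPolynomial.rename Fin.castSucc).toRingHom = ι
    refine MvPolynomial.ringHom_ext (fun a => ?_) fun i => ?_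
    · simp [ψ]
    · fin_cases i <;> simp [ψ]
  have hker : J.map (fermatInclusion K) ≤ RingHom.ker φ := by
    refine Ideal.map_le_iff_le_comap.mpr fun a ha => ?_
    rw [Ideal.mem_comap, RingHom.mem_ker, ← RingHom.comp_apply, hφ, RingHom.comp_apply,
      Ideal.Quotient.eq_zero_iff_mem.mpr ha, map_zero]
  have hι : ι f = 0 := by
    rw [← hφ]
    exact hker hf
  have hmonic : g.Monic := Polynomial.monic_X_pow_sub_C s (by norm_num)
  have hdeg : 0 < g.natDegree := by
    rw [Polynomial.natDegree_X_pow_sub_C]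
    norm_num
  exact Ideal.Quotient.eq_zero_iff_mem.mp
    ((injective_iff_map_eq_zero _).mp (hmonic.adjoinRoot_of_injective hdeg) _ hι)

open MvPolynomial in
theorem C_mul_X_pow_mul_X_pow_notMem {K : Type*} [Field K] {c : K} (hc : c ≠ 0) {a b : ℕ}
    (hab : a < b) :
    C c * ((X 0 : MvPolynomial (Fin 2) K) ^ a * X 1 ^ a) ∉
      Ideal.span {(X 0 : MvPolynomial (Fin 2) K) ^ b, X 1 ^ b} := by
  intro h
  have himage : ({(X 0 : MvPolynomial (Fin 2) K) ^ b, X 1 ^ b} : Set _) =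
      (fun s => monomial s (1 : K)) '' {Finsupp.single 0 b, Finsupp.single 1 b} := by
    simp [Set.image_pair, X_pow_eq_monomial]
  have hmon : C c * ((X 0 : MvPolynomial (Fin 2) K) ^ a * X 1 ^ a) =
      monomial (Finsupp.single 0 a + Finsupp.single 1 a) c := by
    simp [X_pow_eq_monomial, monomial_mul, C_mul_monomial]
  rw [himage, hmon, mem_ideal_span_monomial_image] at h
  obtain ⟨s, hs, hle⟩ := h (Finsupp.single 0 a + Finsupp.single 1 a) (by simp [hc])
  rcases hs with rfl | rfl
  · have := hle 0
    simp at this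
    omega
  · have := hle 1
    simp at this
    omega

theorem padeCoeff_two_mul_ne_zero (K : Type*) [Field K] {p ℓ : ℕ} [CharP K p] (hp : p.Prime)
    (hℓ : 3 * ℓ < p) : (padeCoeff (2 * ℓ) ℓ : K) ≠ 0 := by
  have hchoose : ((3 * ℓ).choose (2 * ℓ) : K) ≠ 0 := by
    rw [Ne, CharP.cast_eq_zero_iff K p]
    intro h
    have hfac := Nat.choose_mul_factorial_mul_factorial (show 2 * ℓ ≤ 3 * ℓ by omega)
    have := (hp.dvd_factorial).mp (hfac ▸ (h.mul_right _).mul_right _)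
    omega
  have h₁ : 2 * (2 * ℓ) - ℓ = 3 * ℓ := by omega
  have h₂ : 2 * ℓ + ℓ = 3 * ℓ := by omega
  rw [padeCoeff, h₁, h₂]
  push_cast
  exact mul_ne_zero (pow_ne_zero _ (by simp)) (mul_ne_zero hchoose hchoose)

open Finset in
/-- Modulo `(x ^ b, y ^ b)`, only the middle term of a sufficiently spread out form survives. -/
theorem sum_mul_pow_sub_middle_mem {T : Type*} [CommRing T] (x y : T) (c : ℕ → T)
    {ℓ d a b : ℕ} (hb : b ≤ d * (ℓ + 1) + a) :
    (∑ j ∈ range (2 * ℓ + 1), c j * (x ^ (d * j) * y ^ (d * (2 * ℓ - j)))) * (x ^ a * y ^ a) -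
      c ℓ * (x ^ (d * ℓ + a) * y ^ (d * ℓ + a)) ∈ Ideal.span {x ^ b, y ^ b} := by
  have hℓ : ℓ ∈ range (2 * ℓ + 1) := mem_range.mpr (by omega)
  have hmid : c ℓ * (x ^ (d * ℓ + a) * y ^ (d * ℓ + a)) =
      c ℓ * (x ^ (d * ℓ) * y ^ (d * (2 * ℓ - ℓ))) * (x ^ a * y ^ a) := by
    rw [show 2 * ℓ - ℓ = ℓ by omega]
    ring
  rw [hmid, ← add_sum_erase _ _ hℓ, add_mul, add_sub_cancel_left, sum_mul]
  refine Ideal.sum_mem _ fun j hj => ?_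
  rw [show c j * (x ^ (d * j) * y ^ (d * (2 * ℓ - j))) * (x ^ a * y ^ a) =
    c j * (x ^ (d * j + a) * y ^ (d * (2 * ℓ - j) + a)) by ring]
  refine Ideal.mul_mem_left _ _ ?_
  obtain ⟨hne, hj⟩ := mem_erase.mp hj
  have hj := mem_range.mp hj
  rcases lt_or_gt_of_ne hne with hlt | hgt
  · refine Ideal.mul_mem_left _ _ (Ideal.mem_of_dvd _ (pow_dvd_pow _ (hb.trans ?_))
      (Ideal.subset_span (Set.mem_insert_of_mem _ rfl)))
    gcongr
    omega
  · refine Ideal.mul_mem_right _ _ (Ideal.mem_of_dvd _ (pow_dvd_pow _ (hb.trans ?_))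
      (Ideal.subset_span (Set.mem_insert _ _)))
    gcongr
    omega

open MvPolynomial in
/-- A multiple of `(x ^ 7 + y ^ 7) ^ N` in `(x ^ b, y ^ b)` transfers membership from the Fermat
ring to `K[x, y]`. -/
theorem mul_mem_of_fermatRing_mem {K : Type*} [Field K] {f H : MvPolynomial (Fin 2) K}
    {b N r : ℕ} (hb : b = 7 * N + r)
    (hf : fermatInclusion K f ∈ Ideal.span {fx K ^ b, fy K ^ b, fz K ^ b})
    (hH : H * (X 0 ^ 7 + X 1 ^ 7) ^ N ∈
      Ideal.span {(X 0 : MvPolynomial (Fin 2) K) ^ b, X 1 ^ b}) :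
    H * f ∈ Ideal.span {(X 0 : MvPolynomial (Fin 2) K) ^ b, X 1 ^ b} := by
  refine mem_of_fermatInclusion_mem_map ?_
  have hmap : Ideal.map (fermatInclusion K)
      (Ideal.span {(X 0 : MvPolynomial (Fin 2) K) ^ b, X 1 ^ b}) =
        Ideal.span {fx K ^ b, fy K ^ b} := by
    simp [Ideal.map_span, Set.image_pair]
  have hHz := Ideal.mem_map_of_mem (fermatInclusion K) hH
  rw [hmap] at hHz ⊢
  simp only [map_mul, map_pow, map_add, fermatInclusion_X_zero, fermatInclusion_X_one,
    ← fz_pow_seven, ← pow_mul] at hHz ⊢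
  obtain ⟨u, v, w, h⟩ := Submodule.mem_span_triple.mp hf
  simp only [smul_eq_mul] at h
  have hfz : fz K ^ b = fz K ^ (7 * N) * fz K ^ r := by rw [hb, pow_add]
  rw [← h, show ∀ t : FermatRing K, t * (u * fx K ^ b + v * fy K ^ b + w * fz K ^ b) =
      (t * u * fx K ^ b + t * v * fy K ^ b) + t * w * fz K ^ b from fun t => by ring]
  refine Ideal.add_mem _ (Ideal.mem_span_pair.mpr ⟨_, _, rfl⟩) ?_
  rw [hfz, show ∀ t s : FermatRing K, t * w * (s * fz K ^ r) = (w * fz K ^ r) * (t * s) from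
    fun t s => by ring]
  exact Ideal.mul_mem_left _ _ hHz

/-- For p = 7ℓ+2 prime with ℓ ≥ 1 and char K = p, in R = K[x,y,z]/(x^7+y^7-z^7)
one has x^{3p²} y^{3p²} ∉ (x^{4p²}, y^{4p²}, z^{4p²}). -/
theorem nonmembership_in_fermatRing {K : Type*} [Field K] (p ℓ : ℕ) (hl : 1 ≤ ℓ)
    (hp : p.Prime) (hpl : p = 7 * ℓ + 2) [CharP K p] :
    fx K ^ (3 * p ^ 2) * fy K ^ (3 * p ^ 2) ∉
      Ideal.span {fx K ^ (4 * p ^ 2), fy K ^ (4 * p ^ 2), fz K ^ (4 * p ^ 2)} := by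
  intro hmem
  have : ExpChar (MvPolynomial (Fin 2) K) p := ExpChar.prime hp
  set x : MvPolynomial (Fin 2) K := MvPolynomial.X 0 with hx
  set y : MvPolynomial (Fin 2) K := MvPolynomial.X 1 with hy
  have hexp : 4 * p ^ 2 = 7 * (p * (2 * (2 * ℓ) + 1) + ℓ) + 2 := by
    subst hpl
    ring
  have htwist := sum_padeCoeff_pow_mul_add_pow_mem p (x ^ 7) (y ^ 7) (2 * ℓ) ℓ
  generalize hN : p * (2 * (2 * ℓ) + 1) + ℓ = N at hexp htwist
  obtain ⟨A, B, hAB⟩ := Ideal.mem_span_pair.mp htwist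
  have hmul := mul_mem_of_fermatRing_mem (f := x ^ (3 * p ^ 2) * y ^ (3 * p ^ 2))
    (H := (∑ j ∈ Finset.range (2 * ℓ + 1), (padeCoeff (2 * ℓ) j : MvPolynomial (Fin 2) K) ^ p *
      ((x ^ 7) ^ (p * j) * (y ^ 7) ^ (p * (2 * ℓ - j)))) * ((x ^ 7) ^ ℓ * (y ^ 7) ^ ℓ) *
        (x ^ 2 * y ^ 2)) hexp (by simpa [hx, hy] using hmem)
    (Ideal.mem_span_pair.mpr ⟨A * y ^ 2, B * x ^ 2, by
      rw [hexp, pow_add, pow_add, pow_mul, pow_mul]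
      linear_combination (x ^ 2 * y ^ 2) * hAB⟩)
  have hmul' := Ideal.mul_mem_left _ (x ^ (7 * ℓ) * y ^ (7 * ℓ)) hmul
  have hsq : 4 * p ^ 2 = 7 * p * ℓ + (14 * ℓ + 2 + 3 * p ^ 2) + 2 := by
    subst hpl
    ring
  have hmiddle := sum_mul_pow_sub_middle_mem x y
    (fun j => (padeCoeff (2 * ℓ) j : MvPolynomial (Fin 2) K) ^ p)
    (ℓ := ℓ) (d := 7 * p) (a := 14 * ℓ + 2 + 3 * p ^ 2) (b := 4 * p ^ 2) (by
      rw [mul_add]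
      have := hp.two_le
      omega)
  have hlast := (Submodule.sub_mem_iff_right _ (by
    convert hmul' using 1
    simp only [← pow_mul, ← mul_assoc 7]
    ring)).mp hmiddle
  refine C_mul_X_pow_mul_X_pow_notMem
    (pow_ne_zero p (padeCoeff_two_mul_ne_zero K hp (by omega : 3 * ℓ < p))) ?_
    (by simpa using hlast)
  omega
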